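/- Let a < b be real numbers and let h ∈ AP(a,b). Then Γ_h is the disjoint union of Γ̃_h and Γ_h^cut, i.e. Γ_h = Γ̃_h ∪ Γ_h^cut and Γ̃_h ∩ Γ_h^cut = ∅. -/

import Mathlib

open MeasureTheory Topology Filter Set

/-- The subgraph `Ω_h = {(x,y) : a < x < b, y < h x}`. -/
def filmSubgraph (a b : ℝ) (h : ℝ → ℝ) : Set (EuclideanSpace ℝ (Fin 2)) :=
  {p | a < p 0 ∧ p 0 < b ∧ p 1 < h (p 0)}

/-- The vertical strip `(a,b) × ℝ`. -/
def filmStrip (a b : ℝ) : Set (EuclideanSpace ℝ (Fin 2)) :=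
  {p | a < p 0 ∧ p 0 < b}

/-- The graph `Γ_h = ∂Ω_h ∩ ((a,b) × ℝ)`. -/
def filmGraph (a b : ℝ) (h : ℝ → ℝ) : Set (EuclideanSpace ℝ (Fin 2)) :=
  frontier (filmSubgraph a b h) ∩ filmStrip a b

/-- `Γ̃_h = ∂(cl Ω_h) ∩ ((a,b) × ℝ)`. -/
def filmGraphTilde (a b : ℝ) (h : ℝ → ℝ) : Set (EuclideanSpace ℝ (Fin 2)) :=
  frontier (closure (filmSubgraph a b h)) ∩ filmStrip a b

/-- `h⁻(x) = liminf_{z → x} h(z)`. -/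
noncomputable def hMinus (h : ℝ → ℝ) (x : ℝ) : ℝ :=
  Filter.liminf h (𝓝[≠] x)

/-- The set of vertical cuts `C(h) = {x ∈ (a,b) : h(x) < h⁻(x)}`. -/
noncomputable def cutSet (a b : ℝ) (h : ℝ → ℝ) : Set ℝ :=
  {x | x ∈ Set.Ioo a b ∧ h x < hMinus h x}

/-- `Γ_h^cut = {(x,y) : x ∈ C(h), h(x) ≤ y < h⁻(x)}`. -/
noncomputable def filmGraphCut (a b : ℝ) (h : ℝ → ℝ) : Set (EuclideanSpace ℝ (Fin 2)) :=
  {p | p 0 ∈ cutSet a b h ∧ h (p 0) ≤ p 1 ∧ p 1 < hMinus h (p 0)}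

theorem isOpen_filmSubgraph {a b : ℝ} {h : ℝ → ℝ}
    (hlsc : LowerSemicontinuousOn h (Set.Icc a b)) : IsOpen (filmSubgraph a b h) := by
  have c0 : Continuous fun q : EuclideanSpace ℝ (Fin 2) => q 0 := by fun_prop
  have c1 : Continuous fun q : EuclideanSpace ℝ (Fin 2) => q 1 := by fun_prop
  rw [isOpen_iff_mem_nhds]
  rintro p ⟨ha, hb, hp⟩
  obtain ⟨c, hc, hc'⟩ := exists_between hp
  have hl := hlsc (p 0) ⟨ha.le, hb.le⟩ c hc'
  rw [nhdsWithin_eq_nhds.2 (Icc_mem_nhds ha hb)] at hl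
  filter_upwards [c0.continuousAt.eventually hl, c0.continuousAt.eventually (lt_mem_nhds ha),
    c0.continuousAt.eventually (gt_mem_nhds hb), c1.continuousAt.eventually (gt_mem_nhds hc)]
    with q h1 h2 h3 h4
  exact ⟨h2, h3, h4.trans h1⟩

theorem mem_interior_closure_filmSubgraph_of_lt_hMinus {a b : ℝ} {h : ℝ → ℝ}
    (hnn : ∀ x ∈ Set.Icc a b, 0 ≤ h x) {p : EuclideanSpace ℝ (Fin 2)}
    (ha : a < p 0) (hb : p 0 < b) (hp : p 1 < hMinus h (p 0)) :
    p ∈ interior (closure (filmSubgraph a b h)) := by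
  have c0 : Continuous fun q : EuclideanSpace ℝ (Fin 2) => q 0 := by fun_prop
  have c1 : Continuous fun q : EuclideanSpace ℝ (Fin 2) => q 1 := by fun_prop
  obtain ⟨m, hm, hm'⟩ := exists_between hp
  have hbdd : IsBoundedUnder (· ≥ ·) (𝓝[≠] (p 0)) h :=
    ⟨0, eventually_map.2 <| mem_of_superset (mem_nhdsWithin_of_mem_nhds (Icc_mem_nhds ha hb)) hnn⟩
  have hev := eventually_lt_of_lt_liminf hm' hbdd
  rw [eventually_nhdsWithin_iff] at hev
  have hev' : ∀ᶠ z in 𝓝 (p 0), z ≠ p 0 → a < z ∧ z < b ∧ m < h z := by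
    filter_upwards [hev, lt_mem_nhds ha, gt_mem_nhds hb] with z h1 h2 h3 hz
    exact ⟨h2, h3, h1 hz⟩
  rw [mem_interior_iff_mem_nhds]
  filter_upwards [c0.continuousAt.eventually hev', c1.continuousAt.eventually (gt_mem_nhds hm)]
    with q h1 h4
  by_cases hq : q 0 = p 0
  · have ct : Tendsto (fun z : ℝ => !₂[z, q 1]) (𝓝[≠] (p 0)) (𝓝 q) := by
      have : Continuous (fun z : ℝ => !₂[z, q 1]) := by fun_prop
      have h2 := this.tendsto (p 0)
      have e : !₂[p 0, q 1] = q := by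
        ext i; fin_cases i <;> simp [hq]
      rw [e] at h2
      exact h2.mono_left nhdsWithin_le_nhds
    refine mem_closure_of_tendsto ct ?_
    filter_upwards [nhdsWithin_le_nhds hev', self_mem_nhdsWithin] with z hz hz'
    obtain ⟨h5, h6, h7⟩ := hz hz'
    exact ⟨by simpa using h5, by simpa using h6, by simpa using h4.trans h7⟩
  · obtain ⟨h5, h6, h7⟩ := h1 hq
    exact subset_closure ⟨h5, h6, h4.trans h7⟩

theorem le_of_tendsto_of_eventually_mem_closure_filmSubgraph {a b : ℝ} {h : ℝ → ℝ}
    {s : Set ℝ} (hs : IsOpen s) {x w L : ℝ} [(𝓝[s] x).NeBot]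
    (hw : ∀ᶠ z in 𝓝 x, !₂[z, w] ∈ closure (filmSubgraph a b h))
    (hL : Tendsto h (𝓝[s] x) (𝓝 L)) : w ≤ L := by
  have c0 : Continuous fun q : EuclideanSpace ℝ (Fin 2) => q 0 := by fun_prop
  have c1 : Continuous fun q : EuclideanSpace ℝ (Fin 2) => q 1 := by fun_prop
  by_contra! hlt
  obtain ⟨c, hc, hc'⟩ := exists_between hlt
  have hev := eventually_eventually_nhdsWithin.2 (hL.eventually (gt_mem_nhds hc))
  obtain ⟨z, ⟨hz, hzc⟩, hzs⟩ :=
    ((hev.and (nhdsWithin_le_nhds hw)).and self_mem_nhdsWithin).exists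
  rw [hs.nhdsWithin_eq hzs] at hz
  have hz' : ∀ᶠ t in 𝓝 ((!₂[z, w] : EuclideanSpace ℝ (Fin 2)) 0), h t < c := by simpa using hz
  have hw' : ∀ᶠ t in 𝓝 ((!₂[z, w] : EuclideanSpace ℝ (Fin 2)) 1), c < t := by
    simpa using lt_mem_nhds hc'
  obtain ⟨q, ⟨-, -, hq⟩, hq1, hq2⟩ := ((mem_closure_iff_frequently.1 hzc).and_eventually
    ((c0.continuousAt.eventually hz').and (c1.continuousAt.eventually hw'))).exists
  exact absurd (hq.trans hq1) hq2.not_gt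

theorem lt_hMinus_of_mem_interior_closure_filmSubgraph {a b : ℝ} {h : ℝ → ℝ}
    (hbv : BoundedVariationOn h (Set.Icc a b)) {p : EuclideanSpace ℝ (Fin 2)}
    (ha : a < p 0) (hb : p 0 < b) (hp : p ∈ interior (closure (filmSubgraph a b h))) :
    p 1 < hMinus h (p 0) := by
  have hI := Icc_mem_nhds ha hb
  obtain ⟨L, hL⟩ := hbv.exists_tendsto_left (p 0)
  obtain ⟨R, hR⟩ := hbv.exists_tendsto_right (p 0)
  rw [nhdsWithin_inter_of_mem (mem_nhdsWithin_of_mem_nhds hI)] at hL hR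
  have hpe : !₂[p 0, p 1] = p := by ext i; fin_cases i <;> simp
  have hcl : ∀ᶠ r : ℝ × ℝ in 𝓝 (p 0) ×ˢ 𝓝 (p 1),
      !₂[r.1, r.2] ∈ closure (filmSubgraph a b h) := by
    have hc : Continuous fun r : ℝ × ℝ => !₂[r.1, r.2] := by fun_prop
    have ht := hc.tendsto (p 0, p 1)
    rw [hpe, nhds_prod_eq] at ht
    exact ht (mem_interior_iff_mem_nhds.1 hp)
  have hcurry : ∀ᶠ w in 𝓝 (p 1), ∀ᶠ z in 𝓝 (p 0), !₂[z, w] ∈ closure (filmSubgraph a b h) :=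
    (eventually_swap_iff.1 hcl).curry
  obtain ⟨w, hw, hpw⟩ : ∃ w, (∀ᶠ z in 𝓝 (p 0), !₂[z, w] ∈ closure (filmSubgraph a b h)) ∧
      w ∈ Ioi (p 1) :=
    ((hcurry.filter_mono (nhdsWithin_le_nhds (s := Ioi (p 1)))).and self_mem_nhdsWithin).exists
  have hwL := le_of_tendsto_of_eventually_mem_closure_filmSubgraph isOpen_Iio hw hL
  have hwR := le_of_tendsto_of_eventually_mem_closure_filmSubgraph isOpen_Ioi hw hR
  obtain ⟨m, hm, hmw⟩ := exists_between (show p 1 < w from hpw)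
  refine hm.trans_le (le_liminf_of_le ?_ ?_)
  · exact (hL.isBoundedUnder_le.isCoboundedUnder_ge).mono (map_mono
      (nhdsWithin_mono _ fun z hz => ne_of_lt hz))
  · rw [← Iio_union_Ioi, nhdsWithin_union, eventually_sup]
    exact ⟨(hL.eventually (lt_mem_nhds (hmw.trans_le hwL))).mono fun _ => le_of_lt,
      (hR.eventually (lt_mem_nhds (hmw.trans_le hwR))).mono fun _ => le_of_lt⟩

/-- For `h ∈ AP(a,b)`, `Γ_h` is the disjoint union of `Γ̃_h`
and `Γ_h^cut`. -/
theorem filmGraph_eq_union_tilde_cut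
    (a b : ℝ) (hab : a < b) (h : ℝ → ℝ)
    (hlsc : LowerSemicontinuousOn h (Set.Icc a b))
    (hnn : ∀ x ∈ Set.Icc a b, 0 ≤ h x)
    (hbv : BoundedVariationOn h (Set.Icc a b)) :
    filmGraph a b h = filmGraphTilde a b h ∪ filmGraphCut a b h ∧
    filmGraphTilde a b h ∩ filmGraphCut a b h = ∅ := by
  have hopen := isOpen_filmSubgraph hlsc
  have hsub := hopen.subset_interior_iff.2 (subset_closure (s := filmSubgraph a b h))
  have key : ∀ p : EuclideanSpace ℝ (Fin 2), a < p 0 → p 0 < b →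
      (p ∈ interior (closure (filmSubgraph a b h)) ↔ p 1 < hMinus h (p 0)) := fun p ha hb =>
    ⟨lt_hMinus_of_mem_interior_closure_filmSubgraph hbv ha hb,
      mem_interior_closure_filmSubgraph_of_lt_hMinus hnn ha hb⟩
  rw [filmGraph, filmGraphTilde, hopen.frontier_eq, isClosed_closure.frontier_eq]
  constructor
  · ext p
    constructor
    · rintro ⟨⟨hcl, hnot⟩, ha, hb⟩
      by_cases hi : p ∈ interior (closure (filmSubgraph a b h))
      · have hle : h (p 0) ≤ p 1 := not_lt.1 fun hlt => hnot ⟨ha, hb, hlt⟩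
        have hlt := (key p ha hb).1 hi
        exact Or.inr ⟨⟨⟨ha, hb⟩, hle.trans_lt hlt⟩, hle, hlt⟩
      · exact Or.inl ⟨⟨hcl, hi⟩, ha, hb⟩
    · rintro (⟨⟨hcl, hi⟩, hstrip⟩ | ⟨⟨⟨ha, hb⟩, -⟩, hle, hlt⟩)
      · exact ⟨⟨hcl, fun hp => hi (hsub hp)⟩, hstrip⟩
      · exact ⟨⟨interior_subset ((key p ha hb).2 hlt), fun hp => hle.not_gt hp.2.2⟩, ha, hb⟩
  · refine eq_empty_iff_forall_notMem.2 ?_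
    rintro p ⟨⟨⟨-, hi⟩, ha, hb⟩, -, -, hlt⟩
    exact hi ((key p ha hb).2 hlt)
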